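/- Let m: Σ → L(X,Y) be a (countable) purely atomic operator-valued measure and let E ∈ Σ be of finite variation of m. If (E_i)_{i∈I} is a decreasing net of sets from Σ with E_i ⊆ E for all i and ⋂_{i∈I} E_i = ∅, then for every ε > 0 and every pair (p,q) ∈ P × Q with q ↦_E p there exists an index i_0 ∈ I such that m̂_{p,q}(E_i) < ε for all i ≥ i_0; that is, lim_{i∈I} m̂_{p,q}(E_i) = 0. -/

import Mathlib

open MeasureTheory Filter Topology Set ENNReal

variable {𝕜 : Type*} [RCLike 𝕜]
variable {T : Type*} [MeasurableSpace T]
variable {X : Type*} [AddCommGroup X] [Module 𝕜 X] [TopologicalSpace X]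
variable {Y : Type*} [AddCommGroup Y] [Module 𝕜 Y] [TopologicalSpace Y]

/-- An operator-valued measure: `m ∅ = 0` and for each `x : X`, the map `E ↦ m E x`
is a countably additive `Y`-valued vector measure. -/
def IsOVMeasure (m : Set T → X →L[𝕜] Y) : Prop :=
  m ∅ = 0 ∧ ∀ (x : X) (E : ℕ → Set T), (∀ n, MeasurableSet (E n)) →
    Pairwise (Function.onFun Disjoint E) →
      HasSum (fun n => m (E n) x) (m (⋃ n, E n) x)

/-- The `(p,q)`-semivariation of `m`. -/
noncomputable def semivar (m : Set T → X →L[𝕜] Y) (p : Seminorm 𝕜 X) (q : Seminorm 𝕜 Y)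
    (E : Set T) : ℝ≥0∞ :=
  ⨆ (N : ℕ) (En : Fin N → Set T) (_ : ∀ n, MeasurableSet (En n))
    (_ : Pairwise (Function.onFun Disjoint En)) (_ : E ⊆ ⋃ n, En n)
    (x : Fin N → X) (_ : ∀ n, p (x n) ≤ 1),
      ENNReal.ofReal (q (∑ n, m (En n ∩ E) (x n)))

/-- `q_p(L) = sup { q (L x) : p x ≤ 1 }`. -/
noncomputable def opSemi (p : Seminorm 𝕜 X) (q : Seminorm 𝕜 Y) (L : X →L[𝕜] Y) : ℝ≥0∞ :=
  ⨆ (x : X) (_ : p x ≤ 1), ENNReal.ofReal (q (L x))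

/-- The `(p,q)`-variation of `m`. -/
noncomputable def varPQ (m : Set T → X →L[𝕜] Y) (p : Seminorm 𝕜 X) (q : Seminorm 𝕜 Y)
    (E : Set T) : ℝ≥0∞ :=
  ⨆ (N : ℕ) (En : Fin N → Set T) (_ : ∀ n, MeasurableSet (En n))
    (_ : Pairwise (Function.onFun Disjoint En)) (_ : E = ⋃ n, En n),
      ∑ n, opSemi p q (m (En n ∩ E))

/-- The inner `(p,q)`-semivariation of `m`. -/
noncomputable def innerSemivar (m : Set T → X →L[𝕜] Y) (p : Seminorm 𝕜 X) (q : Seminorm 𝕜 Y)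
    (G : Set T) : ℝ≥0∞ :=
  ⨆ (F : Set T) (_ : MeasurableSet F) (_ : F ⊆ G), semivar m p q F

/-- `E` is of finite variation of `m`: for every `q ∈ Q` there is `p ∈ P` with
`var_{p,q}(m,E) < ∞` (the relation `q ↦_E p`). -/
def FiniteVar (P : Set (Seminorm 𝕜 X)) (Q : Set (Seminorm 𝕜 Y)) (m : Set T → X →L[𝕜] Y)
    (E : Set T) : Prop :=
  ∀ q ∈ Q, ∃ p ∈ P, varPQ m p q E < ⊤

/-- `E` is of positive variation of `m`. -/
def PositiveVar (P : Set (Seminorm 𝕜 X)) (Q : Set (Seminorm 𝕜 Y)) (m : Set T → X →L[𝕜] Y)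
    (E : Set T) : Prop :=
  ∃ p ∈ P, ∃ q ∈ Q, 0 < varPQ m p q E

/-- Condition (GB). -/
def ConditionGB (P : Set (Seminorm 𝕜 X)) (Q : Set (Seminorm 𝕜 Y))
    (m : Set T → X →L[𝕜] Y) : Prop :=
  ∀ E : Set T, MeasurableSet E → FiniteVar P Q m E → PositiveVar P Q m E →
    ∀ (ι : Type*) [Preorder ι] [IsDirected ι (· ≤ ·)] [Nonempty ι],
      ∀ Ei : ι → Set T, (∀ i, MeasurableSet (Ei i)) → (∀ i, Ei i ⊆ E) →
        (∃ δ : Seminorm 𝕜 X → Seminorm 𝕜 Y → ℝ,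
          ∀ p ∈ P, ∀ q ∈ Q, varPQ m p q E < ⊤ →
            0 < δ p q ∧ ∀ i, ENNReal.ofReal (δ p q) ≤ semivar m p q (Ei i)) →
        (⋂ i, ⋃ j, ⋃ _ : i ≤ j, Ei j).Nonempty

/-- An `m̂`-atom: a measurable set of positive semivariation whose nonempty proper
subsets are all nonmeasurable. -/
def IsMAtom (P : Set (Seminorm 𝕜 X)) (Q : Set (Seminorm 𝕜 Y)) (m : Set T → X →L[𝕜] Y)
    (A : Set T) : Prop :=
  MeasurableSet A ∧ (∃ p ∈ P, ∃ q ∈ Q, 0 < semivar m p q A) ∧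
    ∀ B : Set T, B ⊂ A → B.Nonempty → ¬ MeasurableSet B

/-- `m` is (countably) purely atomic: every measurable set is a countable union of
`m̂`-atoms. -/
def IsAtomicMeasure (P : Set (Seminorm 𝕜 X)) (Q : Set (Seminorm 𝕜 Y)) (m : Set T → X →L[𝕜] Y) :
    Prop :=
  ∀ E : Set T, MeasurableSet E →
    ∃ 𝒜 : Set (Set T), 𝒜.Countable ∧ (∀ A ∈ 𝒜, IsMAtom P Q m A) ∧ E = ⋃₀ 𝒜

/-- The semivariation of `m` is generalized strongly continuous (GS-continuous). -/
def GSContinuous (P : Set (Seminorm 𝕜 X)) (Q : Set (Seminorm 𝕜 Y))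
    (m : Set T → X →L[𝕜] Y) : Prop :=
  ∀ E : Set T, MeasurableSet E → FiniteVar P Q m E →
    ∀ (ι : Type*) [Preorder ι] [IsDirected ι (· ≤ ·)] [Nonempty ι],
      ∀ Ei : ι → Set T, (∀ i, Ei i ⊆ E) →
        ∀ p ∈ P, ∀ q ∈ Q, varPQ m p q E < ⊤ →
          (Monotone Ei → Tendsto (fun i => innerSemivar m p q (Ei i)) atTop
              (𝓝 (innerSemivar m p q (⋃ i, Ei i)))) ∧
          (Antitone Ei → Tendsto (fun i => innerSemivar m p q (Ei i)) atTop
              (𝓝 (innerSemivar m p q (⋂ i, Ei i))))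

/-- A function `f : T → X` is measurable if `{t : p (f t) ≥ η} ∈ Σ` for all `η > 0`, `p ∈ P`. -/
def MeasFun (P : Set (Seminorm 𝕜 X)) (f : T → X) : Prop :=
  ∀ η : ℝ, 0 < η → ∀ p ∈ P, MeasurableSet {t | η ≤ p (f t)}

/-- A measurable set whose only measurable subsets are `∅` and the set itself. -/
def IsIndecomposable (A : Set T) : Prop :=
  MeasurableSet A ∧ ∀ B ⊆ A, MeasurableSet B → B = ∅ ∨ B = A

theorem IsMAtom.isIndecomposable {P : Set (Seminorm 𝕜 X)} {Q : Set (Seminorm 𝕜 Y)}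
    {m : Set T → X →L[𝕜] Y} {A : Set T} (hA : IsMAtom P Q m A) : IsIndecomposable A := by
  refine ⟨hA.1, fun B hBA hB => ?_⟩
  by_contra! h
  exact hA.2.2 B (hBA.ssubset_of_ne h.2) h.1 hB

theorem IsIndecomposable.subset {A B : Set T} (hA : IsIndecomposable A) (hBA : B ⊆ A)
    (hB : MeasurableSet B) : IsIndecomposable B := by
  refine ⟨hB, fun C hCB hC => ?_⟩
  rcases hA.2 C (hCB.trans hBA) hC with h | h
  · exact Or.inl h
  · exact Or.inr (hCB.antisymm (h ▸ hBA))

/-- For an atomic measure, every measurable set is the union of a disjoint sequence of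
indecomposable sets. -/
theorem IsAtomicMeasure.exists_seq_indecomposable {P : Set (Seminorm 𝕜 X)}
    {Q : Set (Seminorm 𝕜 Y)} {m : Set T → X →L[𝕜] Y} (h : IsAtomicMeasure P Q m)
    {E : Set T} (hE : MeasurableSet E) :
    ∃ A : ℕ → Set T, (∀ k, IsIndecomposable (A k)) ∧ Pairwise (Function.onFun Disjoint A) ∧
      E = ⋃ k, A k := by
  obtain ⟨𝒜, hc, hatom, rfl⟩ := h E hE
  obtain ⟨f, hf⟩ := (hc.insert ∅).exists_eq_range (insert_nonempty ∅ 𝒜)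
  have hfind : ∀ k, IsIndecomposable (f k) := fun k => by
    have hk : f k ∈ insert ∅ 𝒜 := hf ▸ mem_range_self k
    rcases hk with hk | hk
    · rw [hk]
      exact ⟨MeasurableSet.empty, fun B hB _ => Or.inl (subset_empty_iff.1 hB)⟩
    · exact (hatom _ hk).isIndecomposable
  refine ⟨disjointed f, fun k => (hfind k).subset (disjointed_subset f k)
    (MeasurableSet.disjointed (fun n => (hfind n).1) k), disjoint_disjointed f, ?_⟩
  rw [iUnion_disjointed, ← sUnion_range, ← hf, sUnion_insert, empty_union]

@[simp]
theorem opSemi_zero (p : Seminorm 𝕜 X) (q : Seminorm 𝕜 Y) : opSemi p q (0 : X →L[𝕜] Y) = 0 := by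
  simp [opSemi]

theorem le_opSemi (p : Seminorm 𝕜 X) (q : Seminorm 𝕜 Y) (L : X →L[𝕜] Y) {x : X}
    (hx : p x ≤ 1) : ENNReal.ofReal (q (L x)) ≤ opSemi p q L :=
  le_iSup₂_of_le x hx le_rfl

theorem Seminorm.ofReal_sum_le {Z κ : Type*} [AddCommGroup Z] [Module 𝕜 Z] (q : Seminorm 𝕜 Z)
    (s : Finset κ) (f : κ → Z) :
    ENNReal.ofReal (q (∑ k ∈ s, f k)) ≤ ∑ k ∈ s, ENNReal.ofReal (q (f k)) := by
  rw [← ENNReal.ofReal_sum_of_nonneg fun _ _ => apply_nonneg q _]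
  refine ENNReal.ofReal_le_ofReal ?_
  exact Finset.le_sum_of_subadditive q (map_zero q).le (map_add_le_add q) s f

theorem Seminorm.ofReal_le_tsum {κ : Type*} {q : Seminorm 𝕜 Y} (hq : Continuous q)
    {f : κ → Y} {y : Y} (hf : HasSum f y) :
    ENNReal.ofReal (q y) ≤ ∑' k, ENNReal.ofReal (q (f k)) := by
  have hlim : Tendsto (fun s : Finset κ => ENNReal.ofReal (q (∑ k ∈ s, f k))) atTop
      (𝓝 (ENNReal.ofReal (q y))) :=
    ((ENNReal.continuous_ofReal.comp hq).tendsto y).comp hf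
  exact le_of_tendsto' hlim fun s => (q.ofReal_sum_le s f).trans (ENNReal.sum_le_tsum s)

/-- At most one member of a disjoint family meets an indecomposable set. -/
theorem IsIndecomposable.sum_opSemi_le {A G : Set T} (hA : IsIndecomposable A)
    (hG : MeasurableSet G) {m : Set T → X →L[𝕜] Y} (hm : m ∅ = 0) (p : Seminorm 𝕜 X)
    (q : Seminorm 𝕜 Y) {N : ℕ} {F : Fin N → Set T} (hF : ∀ n, MeasurableSet (F n))
    (hdisj : Pairwise (Function.onFun Disjoint F)) :
    ∑ n, opSemi p q (m (F n ∩ G ∩ A)) ≤ opSemi p q (m (G ∩ A)) := by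
  have hGA : IsIndecomposable (G ∩ A) := hA.subset inter_subset_right (hG.inter hA.1)
  by_cases hne : ∃ n, (F n ∩ G ∩ A).Nonempty
  · obtain ⟨n, hn⟩ := hne
    have heq : F n ∩ G ∩ A = G ∩ A :=
      (hGA.2 _ (by rw [inter_assoc]; exact inter_subset_right)
        (((hF n).inter hG).inter hA.1)).resolve_left hn.ne_empty
    rw [Finset.sum_eq_single n, heq]
    · intro k _ hk
      have hsub : F k ∩ G ∩ A ⊆ F k ∩ F n := by
        rw [inter_assoc, ← heq, inter_assoc]
        exact inter_subset_inter_right _ inter_subset_left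
      rw [(hdisj hk).inter_eq, subset_empty_iff] at hsub
      rw [hsub, hm, opSemi_zero]
    · simp
  · have h0 : ∀ n, F n ∩ G ∩ A = ∅ := fun n => not_nonempty_iff_eq_empty.1 fun h => hne ⟨n, h⟩
    simp [h0, hm]

/-- The semivariation of a set is dominated by the sum of the operator seminorms of its pieces. -/
theorem semivar_le_tsum_opSemi {m : Set T → X →L[𝕜] Y} (hm : IsOVMeasure m)
    (p : Seminorm 𝕜 X) {q : Seminorm 𝕜 Y} (hq : Continuous q) {A : ℕ → Set T}
    (hA : ∀ k, IsIndecomposable (A k)) (hdisj : Pairwise (Function.onFun Disjoint A))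
    {G : Set T} (hG : MeasurableSet G) (hGA : G ⊆ ⋃ k, A k) :
    semivar m p q G ≤ ∑' k, opSemi p q (m (G ∩ A k)) := by
  refine iSup_le fun N => iSup_le fun F => iSup_le fun hF => iSup_le fun hFd =>
    iSup_le fun _ => iSup_le fun x => iSup_le fun hx => ?_
  have hsum : ∀ n, HasSum (fun k => m (F n ∩ G ∩ A k) (x n)) (m (F n ∩ G) (x n)) := fun n => by
    have h := hm.2 (x n) (fun k => F n ∩ G ∩ A k)
      (fun k => ((hF n).inter hG).inter (hA k).1)
      (fun i j hij => (hdisj hij).mono inter_subset_right inter_subset_right)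
    rwa [← inter_iUnion, inter_eq_left.2 (inter_subset_right.trans hGA)] at h
  calc ENNReal.ofReal (q (∑ n, m (F n ∩ G) (x n)))
      ≤ ∑ n, ENNReal.ofReal (q (m (F n ∩ G) (x n))) := q.ofReal_sum_le _ _
    _ ≤ ∑ n, ∑' k, opSemi p q (m (F n ∩ G ∩ A k)) := by
        refine Finset.sum_le_sum fun n _ => (Seminorm.ofReal_le_tsum hq (hsum n)).trans ?_
        exact ENNReal.tsum_le_tsum fun k => le_opSemi p q _ (hx n)
    _ = ∑' k, ∑ n, opSemi p q (m (F n ∩ G ∩ A k)) :=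
        (Summable.tsum_finsetSum fun _ _ => ENNReal.summable).symm
    _ ≤ ∑' k, opSemi p q (m (G ∩ A k)) :=
        ENNReal.tsum_le_tsum fun k => (hA k).sum_opSemi_le hG hm.1 p q hF hFd

theorem tsum_opSemi_le_varPQ (m : Set T → X →L[𝕜] Y) (p : Seminorm 𝕜 X) (q : Seminorm 𝕜 Y)
    {A : ℕ → Set T} (hA : ∀ k, MeasurableSet (A k))
    (hdisj : Pairwise (Function.onFun Disjoint A)) :
    ∑' k, opSemi p q (m (A k)) ≤ varPQ m p q (⋃ k, A k) := by
  refine ENNReal.tsum_le_of_sum_range_le fun K => ?_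
  let R : Set T := (⋃ k, A k) \ ⋃ k : Fin K, A k
  let F : Fin (K + 1) → Set T := Fin.cons R fun k => A k
  have hF : ∀ n, MeasurableSet (F n) := Fin.cases
    ((MeasurableSet.iUnion hA).diff (MeasurableSet.iUnion fun k : Fin K => hA k))
    fun k => hA k
  have hR : ∀ k : Fin K, Disjoint R (A k) := fun k =>
    disjoint_sdiff_left.mono_right (subset_iUnion (fun k : Fin K => A k) k)
  have hFd : Pairwise (Function.onFun Disjoint F) := by
    intro i j
    cases i using Fin.cases <;> cases j using Fin.cases
    · exact fun h => (h rfl).elim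
    · exact fun _ => hR _
    · exact fun _ => (hR _).symm
    · rename_i i j
      exact fun h => hdisj fun hij => h (congrArg Fin.succ (Fin.ext hij))
  have hsub : (⋃ k : Fin K, A k) ⊆ ⋃ k, A k := iUnion_subset fun k => subset_iUnion A k
  have hFU : (⋃ k, A k) = ⋃ n, F n := by
    rw [show (⋃ n, F n) = R ∪ ⋃ k : Fin K, A k by
      ext t; simp [F]]
    exact (sdiff_union_of_subset hsub).symm
  have hle : ∑ n, opSemi p q (m (F n ∩ ⋃ k, A k)) ≤ varPQ m p q (⋃ k, A k) :=
    le_iSup_of_le (K + 1) <| le_iSup_of_le F <| le_iSup_of_le hF <| le_iSup_of_le hFd <|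
      le_iSup_of_le hFU le_rfl
  refine le_trans ?_ hle
  rw [Fin.sum_univ_succ, Finset.sum_range]
  refine le_add_left (Finset.sum_le_sum fun k _ => ?_)
  simp only [F, Fin.cons_succ]
  rw [inter_eq_left.2 (subset_iUnion A k)]

/-- A decreasing net of measurable sets with empty intersection eventually avoids any given
indecomposable set. -/
theorem IsIndecomposable.eventually_inter_eq_empty {A : Set T} (hA : IsIndecomposable A)
    {ι : Type*} [Preorder ι] [IsDirected ι (· ≤ ·)] [Nonempty ι] {G : ι → Set T}
    (hG : ∀ i, MeasurableSet (G i)) (hanti : Antitone G) (hempty : ⋂ i, G i = ∅) :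
    ∀ᶠ i in atTop, G i ∩ A = ∅ := by
  rcases A.eq_empty_or_nonempty with rfl | ⟨t, ht⟩
  · simp
  have htG : t ∉ ⋂ i, G i := hempty ▸ notMem_empty t
  obtain ⟨i₀, hi₀⟩ := not_forall.1 (mt mem_iInter.2 htG)
  filter_upwards [eventually_ge_atTop i₀] with i hi
  refine (hA.2 _ inter_subset_right ((hG i).inter hA.1)).resolve_right fun h => ?_
  have ht' : t ∈ G i ∩ A := by rwa [h]
  exact hi₀ (hanti hi ht'.1)

variable [T2Space X] [T2Space Y]

theorem atomic_semivar_tendsto_zero_of_decreasing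
    (P : Set (Seminorm 𝕜 X)) (Q : Set (Seminorm 𝕜 Y)) [Nonempty P] [Nonempty Q]
    (hP : WithSeminorms (fun p : P => (p : Seminorm 𝕜 X)))
    (hQ : WithSeminorms (fun q : Q => (q : Seminorm 𝕜 Y)))
    (m : Set T → X →L[𝕜] Y) (hm : IsOVMeasure m)
    (hatomic : IsAtomicMeasure P Q m)
    (E : Set T) (hE : MeasurableSet E) (hfin : FiniteVar P Q m E)
    {ι : Type*} [Preorder ι] [IsDirected ι (· ≤ ·)] [Nonempty ι]
    (Ei : ι → Set T) (hEimeas : ∀ i, MeasurableSet (Ei i)) (hEisub : ∀ i, Ei i ⊆ E)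
    (hanti : Antitone Ei) (hempty : ⋂ i, Ei i = ∅) :
    ∀ p ∈ P, ∀ q ∈ Q, varPQ m p q E < ⊤ →
      (∀ ε : ℝ, 0 < ε → ∃ i₀ : ι, ∀ i ≥ i₀, semivar m p q (Ei i) < ENNReal.ofReal ε) ∧
      Tendsto (fun i => semivar m p q (Ei i)) atTop (𝓝 0) := by
  intro p _ q hqQ hvar
  obtain ⟨A, hA, hdisj, rfl⟩ := hatomic.exists_seq_indecomposable hE
  have hq : Continuous q := hQ.continuous_seminorm ⟨q, hqQ⟩
  have hfinsum : ∑' k, opSemi p q (m (A k)) ≠ ⊤ :=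
    ((tsum_opSemi_le_varPQ m p q (fun k => (hA k).1) hdisj).trans_lt hvar).ne
  have hpiece : ∀ i k, opSemi p q (m (Ei i ∩ A k)) ≤ opSemi p q (m (A k)) := fun i k => by
    rcases (hA k).2 _ inter_subset_right ((hEimeas i).inter (hA k).1) with h | h
    · simp [h, hm.1]
    · rw [h]
  have hev : ∀ ε : ℝ≥0∞, 0 < ε → ∀ᶠ i in atTop, semivar m p q (Ei i) < ε := by
    intro ε hε
    obtain ⟨s, hs⟩ :=
      ((ENNReal.tendsto_tsum_compl_atTop_zero hfinsum).eventually (gt_mem_nhds hε)).exists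
    have havoid : ∀ᶠ i in atTop, ∀ k ∈ s, Ei i ∩ A k = ∅ :=
      (Filter.eventually_all_finset s).2 fun k _ =>
        (hA k).eventually_inter_eq_empty hEimeas hanti hempty
    filter_upwards [havoid] with i hi
    refine lt_of_le_of_lt ?_ hs
    calc semivar m p q (Ei i)
        ≤ ∑' k, opSemi p q (m (Ei i ∩ A k)) :=
          semivar_le_tsum_opSemi hm p hq hA hdisj (hEimeas i) (hEisub i)
      _ = ∑' k : {k // k ∉ s}, opSemi p q (m (Ei i ∩ A k)) := by
          refine (tsum_subtype_eq_of_support_subset (s := {k | k ∉ s}) fun k hk hks => hk ?_).symm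
          rw [hi k hks, hm.1, opSemi_zero]
      _ ≤ ∑' k : {k // k ∉ s}, opSemi p q (m (A k)) :=
          ENNReal.tsum_le_tsum fun k => hpiece i k
  refine ⟨fun ε hε => eventually_atTop.1 (hev _ (ENNReal.ofReal_pos.2 hε)), ?_⟩
  rw [tendsto_order]
  exact ⟨fun a ha => (not_lt_bot ha).elim, hev⟩
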